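/- Let 0 < α < 1, C > 0, and let S be a positive random variable with continuous density f on (0,∞) satisfying y·f(y) = C·E[(y − S)^{−α} 1_{S < y}] for all y > 0. Then E[e^{−λS}] = exp(−(C Γ(1−α)/α) λ^α) for all λ ≥ 0, i.e. S is a positive stable random variable of index α. -/

import Mathlib

open MeasureTheory Set Real

theorem stable_from_fractional_identity (α C : ℝ) (hα0 : 0 < α) (hα1 : α < 1)
    (hC : 0 < C) (f : ℝ → ℝ) (hf_cont : ContinuousOn f (Ioi 0))
    (hf_nonneg : ∀ x, 0 < x → 0 ≤ f x)
    (hf_density : ∫ x in Ioi (0:ℝ), f x = 1)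
    (hf_eq : ∀ y : ℝ, 0 < y →
      y * f y = C * ∫ s in Ioo (0:ℝ) y, (y - s) ^ (-α) * f s) :
    ∀ l : ℝ, 0 ≤ l →
      ∫ s in Ioi (0:ℝ), Real.exp (-(l * s)) * f s
        = Real.exp (-(C * Real.Gamma (1 - α) / α) * l ^ α) := by
  have hfint : IntegrableOn f (Ioi 0) :=
    .of_integral_ne_zero (by rw [hf_density]; exact one_ne_zero)
  have hmeas : ∀ l : ℝ, AEStronglyMeasurable (fun s => Real.exp (-(l * s)) * f s)
      (volume.restrict (Ioi 0)) := fun l =>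
    (by fun_prop : Continuous fun s : ℝ => Real.exp (-(l * s))).aestronglyMeasurable.mul
      hfint.aestronglyMeasurable
  have hbd : ∀ l : ℝ, 0 ≤ l → ∀ᵐ s ∂(volume.restrict (Ioi (0:ℝ))),
      ‖Real.exp (-(l * s)) * f s‖ ≤ f s := by
    intro l hl
    filter_upwards [ae_restrict_mem measurableSet_Ioi] with s hs
    have hs : 0 < s := hs
    have h0 := hf_nonneg s hs
    rw [Real.norm_of_nonneg (by positivity)]
    have : Real.exp (-(l * s)) ≤ 1 := by
      apply Real.exp_le_one_iff.2
      have := mul_nonneg hl hs.le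
      linarith
    nlinarith
  have hint : ∀ l : ℝ, 0 ≤ l → IntegrableOn (fun s => Real.exp (-(l * s)) * f s) (Ioi 0) :=
    fun l hl => Integrable.mono' hfint (hmeas l) (hbd l hl)
  set φ : ℝ → ℝ := fun l => ∫ s in Ioi (0:ℝ), Real.exp (-(l * s)) * f s with hφ
  -- Laplace transform of the identity
  have hlap : ∀ l : ℝ, 0 < l → ∫ y in Ioi (0:ℝ), y * (Real.exp (-(l * y)) * f y)
      = C * Real.Gamma (1 - α) * l ^ (α - 1) * φ l := by
    intro l hl
    have hG := Real.integral_rpow_mul_exp_neg_mul_Ioi (a := 1 - α) (r := l) (by linarith) hl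
    have hGi : IntegrableOn (fun t : ℝ => t ^ (1 - α - 1) * Real.exp (-(l * t))) (Ioi 0) := by
      refine .of_integral_ne_zero ?_
      rw [hG]
      have := Real.Gamma_pos_of_pos (s := 1 - α) (by linarith)
      positivity
    have key := integral_posConvolution (hint l hl.le) hGi (ContinuousLinearMap.mul ℝ ℝ)
    rw [hG] at key
    have e : ∀ y ∈ Ioi (0:ℝ), y * (Real.exp (-(l * y)) * f y)
        = C * ∫ t in (0:ℝ)..y, ContinuousLinearMap.mul ℝ ℝ (Real.exp (-(l * t)) * f t)
          ((y - t) ^ (1 - α - 1) * Real.exp (-(l * (y - t)))) := by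
      intro y hy
      have hy : 0 < y := hy
      rw [intervalIntegral.integral_of_le hy.le, integral_Ioc_eq_integral_Ioo]
      have : y * (Real.exp (-(l * y)) * f y) = Real.exp (-(l * y)) * (y * f y) := by ring
      rw [this, hf_eq y hy, mul_left_comm, ← integral_const_mul]
      congr 1
      refine setIntegral_congr_fun measurableSet_Ioo fun t ht => ?_
      have h1 : Real.exp (-(l * y)) = Real.exp (-(l * t)) * Real.exp (-(l * (y - t))) := by
        rw [← Real.exp_add]; congr 1; ring
      have h2 : 1 - α - 1 = -α := by ring
      simp only [ContinuousLinearMap.mul_apply', h1, h2]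
      ring
    rw [setIntegral_congr_fun measurableSet_Ioi e, integral_const_mul, key,
      ContinuousLinearMap.mul_apply']
    have h3 : (1 / l) ^ (1 - α) = l ^ (α - 1) := by
      rw [one_div, Real.inv_rpow hl.le, ← Real.rpow_neg hl.le]; congr 1; ring
    rw [h3]
    ring
  have hderiv : ∀ l : ℝ, 0 < l →
      HasDerivAt φ (-(C * Real.Gamma (1 - α) * l ^ (α - 1) * φ l)) l := by
    intro l hl
    rw [← hlap l hl, ← integral_neg]
    refine (hasDerivAt_integral_of_dominated_loc_of_deriv_le
      (F := fun l s => Real.exp (-(l * s)) * f s)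
      (F' := fun l s => -(s * (Real.exp (-(l * s)) * f s)))
      (s := Ioi (l / 2)) (bound := fun s => (2 / l) * f s)
      (Ioi_mem_nhds (by linarith)) (.of_forall hmeas) (hint l hl.le) ?_ ?_ ?_ ?_).2
    · exact (continuous_id.aestronglyMeasurable.mul (hmeas l)).neg
    · filter_upwards [ae_restrict_mem measurableSet_Ioi] with s hs x hx
      have hs : 0 < s := hs
      have hx : l / 2 < x := hx
      have h0 := hf_nonneg s hs
      rw [norm_neg, Real.norm_of_nonneg (by positivity), ← mul_assoc]
      refine mul_le_mul_of_nonneg_right ?_ h0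
      rw [Real.exp_neg, ← div_eq_mul_inv, div_le_div_iff₀ (Real.exp_pos _) hl]
      have := Real.add_one_le_exp (x * s)
      nlinarith
    · exact hfint.const_mul _
    · filter_upwards with s x hx
      have h1 : HasDerivAt (fun x : ℝ => -(x * s)) (-(1 * s)) x :=
        ((hasDerivAt_id x).mul_const s).neg
      have h2 := h1.exp.mul_const (f s)
      convert! h2 using 1
      ring
  have hcont : ContinuousOn φ (Ici 0) := by
    refine continuousOn_of_dominated (bound := f) (fun l _ => hmeas l) (fun l hl => hbd l hl)
      hfint ?_
    filter_upwards with s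
    fun_prop
  have hφ0 : φ 0 = 1 := by simp [hφ, hf_density]
  intro l hl
  change φ l = _
  rcases hl.eq_or_lt with rfl | hl
  · rw [hφ0, Real.zero_rpow hα0.ne']; simp
  set K := C * Real.Gamma (1 - α) / α with hK
  obtain ⟨c, hc, h⟩ := exists_hasDerivAt_eq_slope (fun x => φ x * Real.exp (K * x ^ α))
    (fun _ => 0) hl
    ((hcont.mono Icc_subset_Ici_self).mul
      (Real.continuous_exp.comp_continuousOn
        (continuousOn_const.mul (Real.continuous_rpow_const hα0.le).continuousOn)))
    (by
      intro x hx
      have h1 := ((Real.hasDerivAt_rpow_const (p := α) (Or.inl hx.1.ne')).const_mul K).exp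
      have h2 := (hderiv x hx.1).mul h1
      convert! h2 using 1
      have : C * Real.Gamma (1 - α) = K * α := by rw [hK]; field_simp
      rw [this]
      ring)
  rw [eq_comm, div_eq_zero_iff] at h
  have h := h.resolve_right (by linarith)
  simp only [hφ0, Real.zero_rpow hα0.ne', mul_zero, Real.exp_zero, mul_one] at h
  rw [neg_mul, Real.exp_neg]
  exact eq_inv_of_mul_eq_one_left (by linarith)
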